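/- (Matrix form of the main positive energy theorem, Theorem 4.1.) If the 4×4 complex Hermitian matrix Q is positive semidefinite, then all of the following hold simultaneously: E₀ ≥ 0; E₀² ≥ c₄² + (1/2)(|c|² + |Ĵ|² + c₄'²); E₀² ≥ (1/2)(|c'|² + |J₍₄₎|²) + (1/4)(|c|² + |Ĵ|² + c₄'²); E₀ ≥ √(A + |c'|² + |J₍₄₎|²) − |c'| − |J₍₄₎|; E₀² ≥ A − 2√2·√D; and E₀² ≥ A − 4√2·√D + √(F₊). -/

import Mathlib

noncomputable section

open Matrix
open scoped ComplexOrder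

/-- Euclidean dot product on ℝ³. -/
def dot3 (u v : Fin 3 → ℝ) : ℝ := u 0 * v 0 + u 1 * v 1 + u 2 * v 2

/-- Cross product on ℝ³. -/
def cross3 (u v : Fin 3 → ℝ) : Fin 3 → ℝ :=
  ![u 1 * v 2 - u 2 * v 1, u 2 * v 0 - u 0 * v 2, u 0 * v 1 - u 1 * v 0]

/-- Euclidean norm on ℝ³. -/
def norm3 (u : Fin 3 → ℝ) : ℝ := Real.sqrt (dot3 u u)

/-- The 4×4 Hermitian matrix Q = [[E, L], [L*, Ê]] from the positive energy theorem. -/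
def Qmat (E₀ c₁ c₂ c₃ c₄ c₁' c₂' c₃' c₄' J₁₂ J₁₃ J₂₃ J₁₄ J₂₄ J₃₄ : ℝ) :
    Matrix (Fin 4) (Fin 4) ℂ :=
  !![((E₀ + c₄ + c₃' - J₃₄ : ℝ) : ℂ),
     (c₁' : ℂ) + Complex.I * (c₂' : ℂ) - (J₁₄ : ℂ) - Complex.I * (J₂₄ : ℂ),
     (c₃ : ℂ) - (c₄' : ℂ) + Complex.I * (J₁₂ : ℂ),
     (c₁ : ℂ) + Complex.I * (c₂ : ℂ) + (J₁₃ : ℂ) + Complex.I * (J₂₃ : ℂ);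
     (c₁' : ℂ) - Complex.I * (c₂' : ℂ) - (J₁₄ : ℂ) + Complex.I * (J₂₄ : ℂ),
     ((E₀ + c₄ - c₃' + J₃₄ : ℝ) : ℂ),
     (c₁ : ℂ) - Complex.I * (c₂ : ℂ) - (J₁₃ : ℂ) + Complex.I * (J₂₃ : ℂ),
     -(c₃ : ℂ) - (c₄' : ℂ) - Complex.I * (J₁₂ : ℂ);
     (c₃ : ℂ) - (c₄' : ℂ) - Complex.I * (J₁₂ : ℂ),
     (c₁ : ℂ) + Complex.I * (c₂ : ℂ) - (J₁₃ : ℂ) - Complex.I * (J₂₃ : ℂ),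
     ((E₀ - c₄ - c₃' - J₃₄ : ℝ) : ℂ),
     -(c₁' : ℂ) - Complex.I * (c₂' : ℂ) - (J₁₄ : ℂ) - Complex.I * (J₂₄ : ℂ);
     (c₁ : ℂ) - Complex.I * (c₂ : ℂ) + (J₁₃ : ℂ) - Complex.I * (J₂₃ : ℂ),
     -(c₃ : ℂ) - (c₄' : ℂ) + Complex.I * (J₁₂ : ℂ),
     -(c₁' : ℂ) + Complex.I * (c₂' : ℂ) - (J₁₄ : ℂ) + Complex.I * (J₂₄ : ℂ),
     ((E₀ - c₄ + c₃' + J₃₄ : ℝ) : ℂ)]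

/-! ### Principal minors of positive semidefinite complex matrices -/

theorem minor_two_nonneg {n : Type*} {M : Matrix n n ℂ} (h : M.PosSemidef) (i j : n) :
    (M i j).re ^ 2 + (M i j).im ^ 2 ≤ (M i i).re * (M j j).re := by
  have hd := (h.submatrix ![i, j]).det_nonneg
  have hs (a b : n) : M b a = star (M a b) := (h.1.apply b a).symm
  have him (a : n) : (M a a).im = 0 := by
    have := congrArg Complex.im (hs a a)
    simp at this
    linarith
  have hr := (Complex.le_def.1 hd).1
  rw [det_fin_two] at hr
  simp [hs i j, him] at hr
  linarith

theorem minor_three_nonneg {n : Type*} {M : Matrix n n ℂ} (h : M.PosSemidef) (i j k : n) :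
    0 ≤ (M i i).re * (M j j).re * (M k k).re
      - (M i i).re * ((M j k).re ^ 2 + (M j k).im ^ 2)
      - (M j j).re * ((M i k).re ^ 2 + (M i k).im ^ 2)
      - (M k k).re * ((M i j).re ^ 2 + (M i j).im ^ 2)
      + 2 * (M i j * M j k * star (M i k)).re := by
  have hd := (h.submatrix ![i, j, k]).det_nonneg
  have hs (a b : n) : M b a = star (M a b) := (h.1.apply b a).symm
  have him (a : n) : (M a a).im = 0 := by
    have := congrArg Complex.im (hs a a)
    simp at this
    linarith
  have hr := (Complex.le_def.1 hd).1
  rw [det_fin_three] at hr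
  simp [hs i j, hs i k, hs j k, him] at hr
  simp
  linarith

theorem det_four_nonneg {M : Matrix (Fin 4) (Fin 4) ℂ} (h : M.PosSemidef) :
    0 ≤ (M 0 0).re * (M 1 1).re * (M 2 2).re * (M 3 3).re
      - (M 0 0).re * (M 1 1).re * ((M 2 3).re ^ 2 + (M 2 3).im ^ 2)
      - (M 0 0).re * (M 2 2).re * ((M 1 3).re ^ 2 + (M 1 3).im ^ 2)
      - (M 0 0).re * (M 3 3).re * ((M 1 2).re ^ 2 + (M 1 2).im ^ 2)
      - (M 1 1).re * (M 2 2).re * ((M 0 3).re ^ 2 + (M 0 3).im ^ 2)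
      - (M 1 1).re * (M 3 3).re * ((M 0 2).re ^ 2 + (M 0 2).im ^ 2)
      - (M 2 2).re * (M 3 3).re * ((M 0 1).re ^ 2 + (M 0 1).im ^ 2)
      + 2 * (M 0 0).re * (M 1 2 * M 2 3 * star (M 1 3)).re
      + 2 * (M 1 1).re * (M 0 2 * M 2 3 * star (M 0 3)).re
      + 2 * (M 2 2).re * (M 0 1 * M 1 3 * star (M 0 3)).re
      + 2 * (M 3 3).re * (M 0 1 * M 1 2 * star (M 0 2)).re
      + ((M 0 1).re ^ 2 + (M 0 1).im ^ 2) * ((M 2 3).re ^ 2 + (M 2 3).im ^ 2)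
      + ((M 0 2).re ^ 2 + (M 0 2).im ^ 2) * ((M 1 3).re ^ 2 + (M 1 3).im ^ 2)
      + ((M 0 3).re ^ 2 + (M 0 3).im ^ 2) * ((M 1 2).re ^ 2 + (M 1 2).im ^ 2)
      - 2 * (M 0 1 * M 1 2 * M 2 3 * star (M 0 3)).re
      - 2 * (M 0 1 * M 1 3 * star (M 2 3) * star (M 0 2)).re
      - 2 * (M 0 2 * star (M 1 2) * M 1 3 * star (M 0 3)).re := by
  have hs (a b : Fin 4) : M b a = star (M a b) := (h.1.apply b a).symm
  have him (a : Fin 4) : (M a a).im = 0 := by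
    have := congrArg Complex.im (hs a a)
    simp at this
    linarith
  have hr := (Complex.le_def.1 h.det_nonneg).1
  rw [det_succ_row_zero] at hr
  simp [Fin.sum_univ_succ, det_fin_three, Fin.succAbove, hs 0 1, hs 0 2, hs 0 3, hs 1 2, hs 1 3,
    hs 2 3, him, show (-1 : ℂ) ^ 3 = -1 by norm_num] at hr
  simp
  linarith

/-! ### Euclidean geometry of `ℝ³` -/

theorem norm3_nonneg (u : Fin 3 → ℝ) : 0 ≤ norm3 u := Real.sqrt_nonneg _

theorem norm3_sq (u : Fin 3 → ℝ) : norm3 u ^ 2 = dot3 u u :=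
  Real.sq_sqrt (by
    simp only [dot3, ← sq]
    positivity)

theorem dot3_sq_add_norm3_cross3_sq (u v : Fin 3 → ℝ) :
    dot3 u v ^ 2 + norm3 (cross3 u v) ^ 2 = norm3 u ^ 2 * norm3 v ^ 2 := by
  simp only [norm3_sq]
  simp [dot3, cross3]
  ring

theorem abs_dot3_le (u v : Fin 3 → ℝ) : |dot3 u v| ≤ norm3 u * norm3 v := by
  refine abs_le_of_sq_le_sq ?_ (mul_nonneg (norm3_nonneg u) (norm3_nonneg v))
  nlinarith [dot3_sq_add_norm3_cross3_sq u v, sq_nonneg (norm3 (cross3 u v))]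

theorem norm3_cross3_le (u v : Fin 3 → ℝ) : norm3 (cross3 u v) ≤ norm3 u * norm3 v := by
  refine le_of_sq_le_sq ?_ (mul_nonneg (norm3_nonneg u) (norm3_nonneg v))
  nlinarith [dot3_sq_add_norm3_cross3_sq u v, sq_nonneg (dot3 u v)]

/-! ### Energy bounds from the coefficients of the characteristic polynomial -/

/-- The cubic invariant is bounded through the Euclidean norms of the charges. -/
theorem neg_cubic_le {E a b : ℝ} (c d K J : Fin 3 → ℝ) (hE : 0 ≤ E)
    (h : E ^ 2 ≥ a ^ 2 + (1 / 2) * (norm3 c ^ 2 + norm3 K ^ 2 + b ^ 2)) :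
    -(dot3 (a • d - b • c) J + dot3 (cross3 c K) d) ≤
      E * (E * (norm3 d + norm3 J) + norm3 d * norm3 J) := by
  have hc := norm3_nonneg c
  have hd := norm3_nonneg d
  have hK := norm3_nonneg K
  have hJ := norm3_nonneg J
  have ha : |a| ≤ E := abs_le_of_sq_le_sq (by nlinarith [sq_nonneg b]) hE
  have hbc : |b| * norm3 c ≤ E ^ 2 := by
    nlinarith [sq_nonneg (|b| - norm3 c), sq_abs b, sq_nonneg a, sq_nonneg (norm3 K)]
  have hcK : norm3 c * norm3 K ≤ E ^ 2 := by
    nlinarith [sq_nonneg (norm3 c - norm3 K), sq_nonneg a, sq_nonneg b]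
  have h₁ : -(a * dot3 d J) ≤ E * (norm3 d * norm3 J) :=
    (neg_le_abs _).trans <| by
      rw [abs_mul]
      exact mul_le_mul ha (abs_dot3_le d J) (abs_nonneg _) hE
  have h₂ : b * dot3 c J ≤ E ^ 2 * norm3 J :=
    calc b * dot3 c J ≤ |b| * |dot3 c J| := by rw [← abs_mul]; exact le_abs_self _
      _ ≤ |b| * (norm3 c * norm3 J) := by gcongr; exact abs_dot3_le c J
      _ = |b| * norm3 c * norm3 J := by ring
      _ ≤ E ^ 2 * norm3 J := by gcongr
  have h₃ : -dot3 (cross3 c K) d ≤ E ^ 2 * norm3 d :=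
    calc -dot3 (cross3 c K) d ≤ norm3 (cross3 c K) * norm3 d :=
          (neg_le_abs _).trans (abs_dot3_le _ _)
      _ ≤ norm3 c * norm3 K * norm3 d := by gcongr; exact norm3_cross3_le c K
      _ ≤ E ^ 2 * norm3 d := by gcongr
  have hX : dot3 (a • d - b • c) J = a * dot3 d J - b * dot3 c J := by
    simp [dot3]
    ring
  rw [hX]
  linarith

/-- The cubic invariant is bounded through the invariant `D`. -/
theorem abs_cubic_le {E : ℝ} (w J z d : Fin 3 → ℝ) (hE : 0 ≤ E)
    (h : norm3 d ^ 2 + norm3 J ^ 2 ≤ 2 * E ^ 2) :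
    |dot3 w J + dot3 z d| ≤ √2 * √(norm3 w ^ 2 + norm3 z ^ 2) * E := by
  refine abs_le_of_sq_le_sq ?_ (by positivity)
  rw [mul_pow, mul_pow, Real.sq_sqrt zero_le_two, Real.sq_sqrt (by positivity)]
  have hwJ := abs_dot3_le w J
  have hzd := abs_dot3_le z d
  calc (dot3 w J + dot3 z d) ^ 2 ≤ (norm3 w * norm3 J + norm3 z * norm3 d) ^ 2 :=
        sq_le_sq' (by linarith [neg_abs_le (dot3 w J), neg_abs_le (dot3 z d)])
          (by linarith [le_abs_self (dot3 w J), le_abs_self (dot3 z d)])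
    _ ≤ (norm3 w ^ 2 + norm3 z ^ 2) * (norm3 d ^ 2 + norm3 J ^ 2) := by
        nlinarith [sq_nonneg (norm3 w * norm3 d - norm3 z * norm3 J)]
    _ ≤ (norm3 w ^ 2 + norm3 z ^ 2) * (2 * E ^ 2) := by gcongr
    _ = 2 * (norm3 w ^ 2 + norm3 z ^ 2) * E ^ 2 := by ring

theorem energy_ge_sqrt_sub {E A X p q : ℝ} (hE : 0 ≤ E) (hp : 0 ≤ p) (hq : 0 ≤ q)
    (hA : A ≤ 4 * E ^ 2) (h : 0 ≤ E ^ 3 - A * E - 2 * X)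
    (hX : -X ≤ E * (E * (p + q) + p * q)) :
    E ≥ √(A + p ^ 2 + q ^ 2) - p - q := by
  have key : A ≤ E ^ 2 + 2 * (E * (p + q) + p * q) := by
    rcases hE.eq_or_lt with rfl | hpos
    · nlinarith [mul_nonneg hp hq]
    · refine le_of_mul_le_mul_left ?_ hpos
      nlinarith
  have : √(A + p ^ 2 + q ^ 2) ≤ E + p + q :=
    Real.sqrt_le_iff.2 ⟨by positivity, by nlinarith⟩
  linarith

theorem energy_sq_ge_sub {E A X T : ℝ} (hE : 0 ≤ E) (hT : 0 ≤ T) (hA : A ≤ 4 * E ^ 2)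
    (h : 0 ≤ E ^ 3 - A * E - 2 * X) (hX : |X| ≤ T * E) :
    E ^ 2 ≥ A - 2 * T := by
  rcases hE.eq_or_lt with rfl | hpos
  · nlinarith
  · have := neg_abs_le X
    have : 0 ≤ E ^ 2 - A + 2 * T := le_of_mul_le_mul_left (by nlinarith) hpos
    linarith

theorem energy_sq_ge_sub_add_sqrt {E A X T F : ℝ} (hE : 0 ≤ E) (hT : 0 ≤ T)
    (h : E ^ 2 ≥ A - 2 * T) (hX : |X| ≤ T * E)
    (hdet : 0 ≤ E ^ 4 - 2 * A * E ^ 2 - 8 * X * E + A ^ 2 - (F + 8 * T * A - 16 * T ^ 2)) :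
    E ^ 2 ≥ A - 4 * T + √(max F 0) := by
  have hXE : -(X * E) ≤ T * E * E := by nlinarith [neg_abs_le X]
  have : √(max F 0) ≤ E ^ 2 - A + 4 * T :=
    Real.sqrt_le_iff.2 ⟨by linarith, max_le (by nlinarith) (sq_nonneg _)⟩
  linarith

theorem stmt6 (E₀ c₁ c₂ c₃ c₄ c₁' c₂' c₃' c₄' J₁₂ J₁₃ J₂₃ J₁₄ J₂₄ J₃₄ : ℝ)
    (hQ : (Qmat E₀ c₁ c₂ c₃ c₄ c₁' c₂' c₃' c₄' J₁₂ J₁₃ J₂₃ J₁₄ J₂₄ J₃₄).PosSemidef) :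
    0 ≤ E₀ ∧
    E₀ ^ 2 ≥ c₄ ^ 2 + (1 / 2) * (norm3 ![c₁, c₂, c₃] ^ 2 + norm3 ![J₂₃, -J₁₃, J₁₂] ^ 2 + c₄' ^ 2) ∧
    E₀ ^ 2 ≥ (1 / 2) * (norm3 ![c₁', c₂', c₃'] ^ 2 + norm3 ![J₁₄, J₂₄, J₃₄] ^ 2)
      + (1 / 4) * (norm3 ![c₁, c₂, c₃] ^ 2 + norm3 ![J₂₃, -J₁₃, J₁₂] ^ 2 + c₄' ^ 2) ∧
    E₀ ≥ Real.sqrt ((c₄ ^ 2 + c₄' ^ 2 + norm3 ![c₁, c₂, c₃] ^ 2 + norm3 ![c₁', c₂', c₃'] ^ 2 + norm3 ![J₂₃, -J₁₃, J₁₂] ^ 2 + norm3 ![J₁₄, J₂₄, J₃₄] ^ 2) + norm3 ![c₁', c₂', c₃'] ^ 2 + norm3 ![J₁₄, J₂₄, J₃₄] ^ 2)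
      - norm3 ![c₁', c₂', c₃'] - norm3 ![J₁₄, J₂₄, J₃₄] ∧
    E₀ ^ 2 ≥ (c₄ ^ 2 + c₄' ^ 2 + norm3 ![c₁, c₂, c₃] ^ 2 + norm3 ![c₁', c₂', c₃'] ^ 2 + norm3 ![J₂₃, -J₁₃, J₁₂] ^ 2 + norm3 ![J₁₄, J₂₄, J₃₄] ^ 2) - 2 * Real.sqrt 2 * Real.sqrt ((c₄ * c₁' - c₄' * c₁) ^ 2 + (c₄ * c₂' - c₄' * c₂) ^ 2 + (c₄ * c₃' - c₄' * c₃) ^ 2 + norm3 (cross3 ![c₁, c₂, c₃] ![J₂₃, -J₁₃, J₁₂]) ^ 2) ∧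
    E₀ ^ 2 ≥ (c₄ ^ 2 + c₄' ^ 2 + norm3 ![c₁, c₂, c₃] ^ 2 + norm3 ![c₁', c₂', c₃'] ^ 2 + norm3 ![J₂₃, -J₁₃, J₁₂] ^ 2 + norm3 ![J₁₄, J₂₄, J₃₄] ^ 2) - 4 * Real.sqrt 2 * Real.sqrt ((c₄ * c₁' - c₄' * c₁) ^ 2 + (c₄ * c₂' - c₄' * c₂) ^ 2 + (c₄ * c₃' - c₄' * c₃) ^ 2 + norm3 (cross3 ![c₁, c₂, c₃] ![J₂₃, -J₁₃, J₁₂]) ^ 2)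
      + Real.sqrt (max (-8 * Real.sqrt 2 * Real.sqrt ((c₄ * c₁' - c₄' * c₁) ^ 2 + (c₄ * c₂' - c₄' * c₂) ^ 2 + (c₄ * c₃' - c₄' * c₃) ^ 2 + norm3 (cross3 ![c₁, c₂, c₃] ![J₂₃, -J₁₃, J₁₂]) ^ 2) * (c₄ ^ 2 + c₄' ^ 2 + norm3 ![c₁, c₂, c₃] ^ 2 + norm3 ![c₁', c₂', c₃'] ^ 2 + norm3 ![J₂₃, -J₁₃, J₁₂] ^ 2 + norm3 ![J₁₄, J₂₄, J₃₄] ^ 2) + 36 * norm3 (cross3 ![c₁, c₂, c₃] ![J₂₃, -J₁₃, J₁₂]) ^ 2 + 4 * norm3 (cross3 ![c₁, c₂, c₃] ![c₁', c₂', c₃']) ^ 2 + 36 * ((c₄ * c₁' - c₄' * c₁) ^ 2 + (c₄ * c₂' - c₄' * c₂) ^ 2 + (c₄ * c₃' - c₄' * c₃) ^ 2) + 4 * (dot3 ![J₁₄, J₂₄, J₃₄] ![c₁', c₂', c₃'] ^ 2 + dot3 ![J₁₄, J₂₄, J₃₄] ![J₂₃, -J₁₃, J₁₂] ^ 2 +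 dot3 ![J₁₄, J₂₄, J₃₄] ![c₁, c₂, c₃] ^ 2) + 4 * norm3 (cross3 ![c₁', c₂', c₃'] ![J₂₃, -J₁₃, J₁₂]) ^ 2 + 4 * norm3 ![J₁₄, J₂₄, J₃₄] ^ 2 * (c₄ ^ 2 + c₄' ^ 2) + 8 * c₄ * dot3 (cross3 ![c₁, c₂, c₃] ![J₂₃, -J₁₃, J₁₂]) ![J₁₄, J₂₄, J₃₄] + 8 * c₄' * dot3 (cross3 ![c₁', c₂', c₃'] ![J₂₃, -J₁₃, J₁₂]) ![J₁₄, J₂₄, J₃₄]) 0) := by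
  have minor₂ (i j : Fin 4) := minor_two_nonneg hQ i j
  have minor₃ (i j k : Fin 4) := minor_three_nonneg hQ i j k
  have hdiag (i : Fin 4) :
      0 ≤ (Qmat E₀ c₁ c₂ c₃ c₄ c₁' c₂' c₃' c₄' J₁₂ J₁₃ J₂₃ J₁₄ J₂₄ J₃₄ i i).re :=
    (Complex.le_def.1 hQ.diag_nonneg).1
  have hdet := det_four_nonneg hQ
  have hE : 0 ≤ E₀ := by
    have h0 := hdiag 0
    have h1 := hdiag 1
    have h2 := hdiag 2
    have h3 := hdiag 3
    simp [Qmat] at h0 h1 h2 h3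
    linarith
  have m01 := minor₂ 0 1
  have m02 := minor₂ 0 2
  have m03 := minor₂ 0 3
  have m12 := minor₂ 1 2
  have m13 := minor₂ 1 3
  have m23 := minor₂ 2 3
  have m012 := minor₃ 0 1 2
  have m013 := minor₃ 0 1 3
  have m023 := minor₃ 0 2 3
  have m123 := minor₃ 1 2 3
  simp [Qmat] at m01 m02 m03 m12 m13 m23 m012 m013 m023 m123 hdet
  set c : Fin 3 → ℝ := ![c₁, c₂, c₃] with hc
  set d : Fin 3 → ℝ := ![c₁', c₂', c₃'] with hd
  set K : Fin 3 → ℝ := ![J₂₃, -J₁₃, J₁₂] with hK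
  set J : Fin 3 → ℝ := ![J₁₄, J₂₄, J₃₄] with hJ
  have hw : (c₄ * c₁' - c₄' * c₁) ^ 2 + (c₄ * c₂' - c₄' * c₂) ^ 2 + (c₄ * c₃' - c₄' * c₃) ^ 2
      = norm3 (c₄ • d - c₄' • c) ^ 2 := by
    simp [norm3_sq, dot3, hc, hd]
    ring
  rw [hw]
  have bound₁ : E₀ ^ 2 ≥ c₄ ^ 2 + (1 / 2) * (norm3 c ^ 2 + norm3 K ^ 2 + c₄' ^ 2) := by
    simp [norm3_sq, dot3, hc, hK]
    linarith
  have bound₂ : E₀ ^ 2 + c₄ ^ 2 ≥ norm3 d ^ 2 + norm3 J ^ 2 := by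
    simp [norm3_sq, dot3, hd, hJ]
    linarith
  set A : ℝ := c₄ ^ 2 + c₄' ^ 2 + norm3 c ^ 2 + norm3 d ^ 2 + norm3 K ^ 2 + norm3 J ^ 2 with hA
  set X : ℝ := dot3 (c₄ • d - c₄' • c) J + dot3 (cross3 c K) d with hX
  set D : ℝ := norm3 (c₄ • d - c₄' • c) ^ 2 + norm3 (cross3 c K) ^ 2 with hD
  have hdJ : norm3 d ^ 2 + norm3 J ^ 2 ≤ 2 * E₀ ^ 2 := by
    linarith [sq_nonneg (norm3 c), sq_nonneg (norm3 K), sq_nonneg c₄']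
  have hA4 : A ≤ 4 * E₀ ^ 2 := by linarith [sq_nonneg c₄]
  have cubic : 0 ≤ E₀ ^ 3 - A * E₀ - 2 * X := by
    simp [hA, hX, norm3_sq, dot3, cross3, hc, hd, hK, hJ]
    linarith
  have hT : 0 ≤ √2 * √D := by positivity
  have hT2 : (√2 * √D) ^ 2 = 2 * D := by
    rw [mul_pow, Real.sq_sqrt zero_le_two, Real.sq_sqrt (by positivity)]
  have hXT : |X| ≤ √2 * √D * E₀ := abs_cubic_le _ _ _ _ hE hdJ
  have bound₃ := energy_sq_ge_sub hE hT hA4 cubic hXT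
  refine ⟨hE, bound₁, by linarith, ?_, by linarith, ?_⟩
  · exact energy_ge_sqrt_sub hE (norm3_nonneg d) (norm3_nonneg J) hA4 cubic
      (neg_cubic_le c d K J hE bound₁)
  · rw [mul_assoc 4]
    refine energy_sq_ge_sub_add_sqrt hE hT bound₃ hXT ?_
    rw [hT2]
    generalize √D = s
    refine (sub_nonneg.2 hdet).trans_eq ?_
    simp [hA, hX, hD, norm3_sq, dot3, cross3, hc, hd, hK, hJ]
    ring
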